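/- For every H with 0 < H < 1 and every real t, one has ∫_{−∞}^{∞} cos(tλ) · sin(πH) cosh(πλ) / (sinh²(πλ) + sin²(πH)) dλ = cosh((2H − 1)t/2)/cosh(t/2). -/

import Mathlib

open Real

lemma sigmoid_subst_aux (u : ℂ) (t : ℝ) :
    |Real.sigmoid t * (1 - Real.sigmoid t)| •
      (((Real.sigmoid t : ℝ) : ℂ) ^ (u - 1) * (1 - ((Real.sigmoid t : ℝ) : ℂ)) ^ ((1 - u) - 1))
      = Complex.exp (u * t) / (1 + Complex.exp t) := by
  have hp : (0:ℝ) < 1 + Real.exp (-t) := by positivity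
  obtain ⟨L, hL⟩ : ∃ L : ℝ, Real.exp L = 1 + Real.exp (-t) := ⟨_, Real.exp_log hp⟩
  have hs : Real.sigmoid t = Real.exp (-L) := by
    rw [Real.sigmoid_def, Real.exp_neg L, hL]
  have hs1 : 1 - Real.sigmoid t = Real.exp (-t - L) := by
    rw [hs, Real.exp_sub, Real.exp_neg L, hL]
    field_simp
    ring
  have hinv : (1 + Complex.exp t)⁻¹ = Complex.exp ((-t - L : ℝ) : ℂ) := by
    rw [← Complex.ofReal_exp, ← Complex.ofReal_exp, Real.exp_sub, hL, Real.exp_neg]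
    have : (0:ℝ) < Real.exp t := Real.exp_pos t
    norm_cast
    field_simp
    ring
  have hc : (1 - ((Real.sigmoid t : ℝ) : ℂ)) = ((Real.exp (-t - L) : ℝ) : ℂ) := by
    rw [← hs1]; push_cast; rfl
  rw [abs_of_pos (by rw [hs1, hs]; positivity), hc, hs1, hs, div_eq_mul_inv, hinv,
    Complex.cpow_def_of_ne_zero (by exact_mod_cast (Real.exp_pos _).ne'),
    Complex.cpow_def_of_ne_zero (by exact_mod_cast (Real.exp_pos _).ne'),
    ← Complex.ofReal_log (Real.exp_pos _).le, ← Complex.ofReal_log (Real.exp_pos _).le,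
    Real.log_exp, Real.log_exp, Complex.real_smul]
  push_cast
  simp only [← Complex.exp_add]
  congr 1
  ring

lemma exp_div_integral (u : ℂ) (h0 : 0 < u.re) (h1 : u.re < 1) :
    MeasureTheory.Integrable (fun t : ℝ => Complex.exp (u * t) / (1 + Complex.exp t)) ∧
    ∫ t : ℝ, Complex.exp (u * t) / (1 + Complex.exp t) = π / Complex.sin (π * u) := by
  have h2 : 0 < (1 - u).re := by simpa using h1
  have hd : ∀ x ∈ (Set.univ : Set ℝ), HasDerivWithinAt Real.sigmoid
      (Real.sigmoid x * (1 - Real.sigmoid x)) Set.univ x :=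
    fun x _ => (hasDerivAt_sigmoid x).hasDerivWithinAt
  have hinj : Set.InjOn Real.sigmoid Set.univ := Real.sigmoid_injective.injOn
  have him : Real.sigmoid '' Set.univ = Set.Ioo 0 1 := by
    rw [Set.image_univ, Real.range_sigmoid]
  constructor
  · have hB := Complex.betaIntegral_convergent h0 h2
    rw [intervalIntegrable_iff_integrableOn_Ioo_of_le zero_le_one, ← him,
      MeasureTheory.integrableOn_image_iff_integrableOn_abs_deriv_smul MeasurableSet.univ hd hinj,
      MeasureTheory.integrableOn_univ] at hB
    simpa only [sigmoid_subst_aux] using hB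
  · have hB := Complex.betaIntegral_eq_Gamma_mul_div u (1 - u) h0 h2
    rw [Complex.Gamma_mul_Gamma_one_sub, add_sub_cancel, Complex.Gamma_one, div_one,
      Complex.betaIntegral, intervalIntegral.integral_of_le zero_le_one,
      MeasureTheory.integral_Ioc_eq_integral_Ioo, ← him,
      MeasureTheory.integral_image_eq_integral_abs_deriv_smul MeasurableSet.univ hd hinj,
      MeasureTheory.setIntegral_univ] at hB
    simpa only [sigmoid_subst_aux] using hB

noncomputable def corrB (H : ℝ) (t : ℝ) : ℂ :=
  ((Real.cosh ((2 * H - 1) * t / 2) / Real.cosh (t / 2) : ℝ) : ℂ)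

noncomputable def specG (H : ℝ) (l : ℝ) : ℝ :=
  Real.sin (π * H) * Real.cosh (π * l) / (Real.sinh (π * l) ^ 2 + Real.sin (π * H) ^ 2)

lemma corrB_eq (H t : ℝ) : corrB H t =
    Complex.exp ((H : ℂ) * t) / (1 + Complex.exp t)
      + Complex.exp ((1 - H : ℂ) * t) / (1 + Complex.exp t) := by
  have : Real.cosh ((2 * H - 1) * t / 2) / Real.cosh (t / 2)
      = Real.exp (H * t) / (1 + Real.exp t) + Real.exp ((1 - H) * t) / (1 + Real.exp t) := by
    rw [Real.cosh_eq, Real.cosh_eq]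
    have e1 : Real.exp (H * t) = Real.exp ((2 * H - 1) * t / 2) * Real.exp (t / 2) := by
      rw [← Real.exp_add]; ring_nf
    have e2 : Real.exp ((1 - H) * t) = Real.exp (-((2 * H - 1) * t / 2)) * Real.exp (t / 2) := by
      rw [← Real.exp_add]; ring_nf
    have e3 : Real.exp t = Real.exp (t / 2) * Real.exp (t / 2) := by
      rw [← Real.exp_add]; ring_nf
    rw [e1, e2, e3, Real.exp_neg (t / 2)]
    have := Real.exp_pos (t / 2)
    field_simp
    ring
  rw [corrB, this]
  push_cast
  rfl

open FourierTransform in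
lemma fourier_corrB (H : ℝ) (hH0 : 0 < H) (hH1 : H < 1) (x : ℝ) :
    𝓕 (corrB H) x = ((2 * π * specG H (2 * π * x) : ℝ) : ℂ) := by
  obtain ⟨i1, v1⟩ := exp_div_integral (H - 2 * π * x * Complex.I) (by simpa using hH0)
    (by simpa using hH1)
  obtain ⟨i2, v2⟩ := exp_div_integral (1 - H - 2 * π * x * Complex.I) (by simpa using hH1)
    (by simpa using hH0)
  have hs : 0 < Real.sin (π * H) :=
    Real.sin_pos_of_pos_of_lt_pi (by positivity) (by nlinarith [Real.pi_pos])
  have hD : (Real.sinh (π * (2 * π * x)) ^ 2 + Real.sin (π * H) ^ 2) ≠ 0 := by positivity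
  rw [Real.fourier_real_eq_integral_exp_smul]
  have : ∀ v : ℝ, Complex.exp (↑(-2 * π * v * x) * Complex.I) • corrB H v =
      Complex.exp ((H - 2 * π * x * Complex.I) * v) / (1 + Complex.exp v)
      + Complex.exp ((1 - H - 2 * π * x * Complex.I) * v) / (1 + Complex.exp v) := by
    intro v
    rw [corrB_eq, smul_eq_mul, mul_add, ← mul_div_assoc, ← mul_div_assoc, ← Complex.exp_add,
      ← Complex.exp_add]
    push_cast
    congr 3 <;> ring_nf
  simp_rw [this]
  rw [MeasureTheory.integral_add i1 i2, v1, v2]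
  have a1 : (π : ℂ) * (H - 2 * π * x * Complex.I) = π * H - (π * (2 * π * x)) * Complex.I := by ring
  have a2 : (π : ℂ) * (1 - H - 2 * π * x * Complex.I)
      = π - (π * H + (π * (2 * π * x)) * Complex.I) := by ring
  rw [a1, a2, Complex.sin_pi_sub, Complex.sin_sub, Complex.sin_add, Complex.cos_mul_I,
    Complex.sin_mul_I, specG]
  have hDc : (Complex.sinh (π * (2 * π * x)) ^ 2 + Complex.sin (π * H) ^ 2) ≠ 0 := by
    exact_mod_cast hD
  push_cast
  have hch := Complex.cosh_sq (π * (2 * π * x) : ℂ)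
  have hcs := Complex.sin_sq_add_cos_sq (π * H : ℂ)
  have hI := Complex.I_sq
  generalize Complex.sinh (π * (2 * π * x) : ℂ) = S at *
  generalize Complex.cosh (π * (2 * π * x) : ℂ) = C at *
  generalize Complex.sin (π * H : ℂ) = s at *
  generalize Complex.cos (π * H : ℂ) = c at *
  have hprod : (s * C - c * (S * Complex.I)) * (s * C + c * (S * Complex.I)) = S ^ 2 + s ^ 2 := by
    linear_combination s ^ 2 * hch + S ^ 2 * hcs - c ^ 2 * S ^ 2 * hI
  have n1 : (s * C - c * (S * Complex.I)) ≠ 0 := fun h => hDc (by rw [← hprod, h, zero_mul])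
  have n2 : (s * C + c * (S * Complex.I)) ≠ 0 := fun h => hDc (by rw [← hprod, h, mul_zero])
  rw [← hprod, div_add_div _ _ n1 n2, ← mul_div_assoc]
  congr 1
  ring

lemma specG_integrable (H : ℝ) (hH0 : 0 < H) (hH1 : H < 1) :
    MeasureTheory.Integrable (specG H) := by
  have hs : 0 < Real.sin (π * H) :=
    Real.sin_pos_of_pos_of_lt_pi (by positivity) (by nlinarith [Real.pi_pos])
  have h := (exp_div_integral (1 / 2) (by norm_num) (by norm_num)).1.norm
  have h' := (h.comp_mul_left' (R := 2 * π) (by positivity)).const_mul (2 / Real.sin (π * H))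
  refine h'.mono' ?_ ?_
  · apply Continuous.aestronglyMeasurable
    unfold specG
    refine Continuous.div (by fun_prop) (by fun_prop) (fun x => by positivity)
  · refine Filter.Eventually.of_forall fun l => ?_
    have e : ‖Complex.exp (1 / 2 * ((2 * π * l : ℝ) : ℂ)) / (1 + Complex.exp ((2 * π * l : ℝ) : ℂ))‖
        = 1 / (2 * Real.cosh (π * l)) := by
      have : Complex.exp (1 / 2 * ((2 * π * l : ℝ) : ℂ)) / (1 + Complex.exp ((2 * π * l : ℝ) : ℂ))
          = ((1 / (2 * Real.cosh (π * l)) : ℝ) : ℂ) := by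
        have e1 : (1 / 2 * ((2 * π * l : ℝ) : ℂ)) = ((π * l : ℝ) : ℂ) := by push_cast; ring
        rw [e1, ← Complex.ofReal_exp, ← Complex.ofReal_exp]
        norm_cast
        have e3 : Real.exp (2 * π * l) = Real.exp (π * l) * Real.exp (π * l) := by
          rw [← Real.exp_add]; ring_nf
        rw [e3, Real.cosh_eq, Real.exp_neg]
        have := Real.exp_pos (π * l)
        field_simp
        ring
      rw [this, Complex.norm_real, Real.norm_of_nonneg]
      have := Real.cosh_pos (π * l)
      positivity
    have hc := Real.cosh_pos (π * l)
    simp only [e]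
    unfold specG
    rw [Real.norm_of_nonneg (by positivity)]
    have : 2 / Real.sin (π * H) * (1 / (2 * Real.cosh (π * l)))
        = 1 / (Real.sin (π * H) * Real.cosh (π * l)) := by field_simp
    rw [this, div_le_div_iff₀ (by positivity) (by positivity)]
    have := Real.cosh_sq (π * l)
    have := Real.sin_sq_le_one (π * H)
    nlinarith [mul_nonneg (sq_nonneg (Real.sinh (π * l))) (sub_nonneg.2 this)]

open FourierTransform in
/-- For every `H` with `0 < H < 1` and every real `t`,
`∫_{−∞}^{∞} cos(tλ) sin(πH) cosh(πλ) / (sinh²(πλ) + sin²(πH)) dλ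
  = cosh((2H − 1)t/2)/cosh(t/2)`. -/
theorem stmt_9 (H t : ℝ) (hH0 : 0 < H) (hH1 : H < 1) :
    ∫ l : ℝ, Real.cos (t * l) * Real.sin (π * H) * Real.cosh (π * l) /
        (Real.sinh (π * l) ^ 2 + Real.sin (π * H) ^ 2)
      = Real.cosh ((2 * H - 1) * t / 2) / Real.cosh (t / 2) := by
  have hG := specG_integrable H hH0 hH1
  have hF : 𝓕 (corrB H) = fun x => ((2 * π * specG H (2 * π * x) : ℝ) : ℂ) :=
    funext (fourier_corrB H hH0 hH1)
  have hFi : MeasureTheory.Integrable (𝓕 (corrB H)) := by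
    rw [hF]
    exact ((hG.comp_mul_left' (R := 2 * π) (by positivity)).const_mul (2 * π)).ofReal
  have hBi : MeasureTheory.Integrable (corrB H) := by
    have i1 := (exp_div_integral (H : ℂ) (by simpa using hH0) (by simpa using hH1)).1
    have i2 := (exp_div_integral (1 - H : ℂ) (by simpa using hH1) (by simpa using hH0)).1
    exact (i1.add i2).congr (Filter.Eventually.of_forall fun t => (corrB_eq H t).symm)
  have hBc : Continuous (corrB H) := by
    unfold corrB
    refine Complex.continuous_ofReal.comp ?_
    exact Continuous.div (by fun_prop) (by fun_prop) (fun x => (Real.cosh_pos _).ne')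
  have key := congrFun (hBc.fourierInv_fourier_eq hBi hFi) t
  rw [hF, Real.fourierInv_eq'] at key
  have e : ∀ v : ℝ, Complex.exp (((2 * π * inner ℝ v t : ℝ) : ℂ) * Complex.I) •
      ((2 * π * specG H (2 * π * v) : ℝ) : ℂ) =
      (fun l : ℝ => 2 * π * (Complex.exp (((t * l : ℝ) : ℂ) * Complex.I) * (specG H l : ℂ)))
        (2 * π * v) := by
    intro v
    have : 2 * π * inner ℝ v t = t * (2 * π * v) := by simp; ring
    rw [this]
    simp only [smul_eq_mul]
    push_cast
    ring
  rw [MeasureTheory.integral_congr_ae (Filter.Eventually.of_forall e)] at key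
  have hcv := MeasureTheory.Measure.integral_comp_mul_left
    (fun l : ℝ => 2 * π * (Complex.exp (((t * l : ℝ) : ℂ) * Complex.I) * (specG H l : ℂ))) (2 * π)
  replace key := hcv.symm.trans key
  rw [MeasureTheory.integral_const_mul,
    abs_of_pos (by positivity), Complex.real_smul, ← mul_assoc] at key
  have hpi : ((2 * π)⁻¹ : ℝ) * (2 * (π : ℂ)) = 1 := by
    push_cast
    have : (π : ℂ) ≠ 0 := by exact_mod_cast Real.pi_ne_zero
    field_simp
  rw [hpi, one_mul] at key
  have hint : MeasureTheory.Integrable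
      (fun l : ℝ => Complex.exp (((t * l : ℝ) : ℂ) * Complex.I) * (specG H l : ℂ)) := by
    refine hG.ofReal.bdd_mul (c := 1) (Continuous.aestronglyMeasurable (by fun_prop)) ?_
    exact Filter.Eventually.of_forall fun l => (Complex.norm_exp_ofReal_mul_I _).le
  have hre := congrArg Complex.re key
  have hre2 := integral_re hint
  simp only [RCLike.re_eq_complex_re] at hre2
  rw [← hre2, corrB, Complex.ofReal_re] at hre
  rw [← hre]
  congr 1
  funext l
  rw [Complex.re_mul_ofReal, Complex.exp_ofReal_mul_I_re, specG]
  ring
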